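/- Let x ∈ (0,1) be irrational. If x is not a square-Brjuno number, i.e. ∑_{n=0}^∞ log(q_{n+1}(x))/q_n(x)^2 = ∞, then F_2 is not differentiable at x, where F_2(x) = ∑_{n=1}^∞ (σ_1(n)/n^3)·sin(2πnx). -/

import Mathlib

open Real Filter

noncomputable section

/-- The sum-of-divisors function `σ₁(n) = ∑_{d ∣ n} d`. -/
def sigma1 (n : ℕ) : ℕ := ∑ d ∈ n.divisors, d

/-- `F₂(x) = ∑_{n=1}^∞ σ₁(n)/n³ · sin(2πnx)`. -/
def F2 (x : ℝ) : ℝ :=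
  ∑' n : ℕ, (sigma1 (n + 1) : ℝ) / ((n : ℝ) + 1) ^ 3 * Real.sin (2 * π * ((n : ℝ) + 1) * x)

/-- The Gauss map: `T 0 = 0` and `T y = 1/y mod 1` otherwise. -/
def gauss (y : ℝ) : ℝ := if y = 0 then 0 else Int.fract y⁻¹

/-- The denominators `q_n(x)` of the continued fraction convergents of `x`:
`q_0 = 1`, `q_1 = a_1 = ⌊1/x⌋`, and `q_{n+2} = a_{n+2} q_{n+1} + q_n`
where `a_i(x) = ⌊1/T^{i-1}(x)⌋`. -/
def qden (x : ℝ) : ℕ → ℤ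
  | 0 => 1
  | 1 => ⌊x⁻¹⌋
  | n + 2 => ⌊(gauss^[n + 1] x)⁻¹⌋ * qden x (n + 1) + qden x n

/-- The Abel-regularised Clausen function `∑ rⁿ sin(2πny)/n²`. -/
def clausen (r y : ℝ) : ℝ := ∑' n : ℕ, r ^ n * (Real.sin (2 * π * n * y) / (n : ℝ) ^ 2)

lemma norm_clausen_term_le {r : ℝ} (hr0 : 0 ≤ r) (hr1 : r ≤ 1) (y : ℝ) (n : ℕ) :
    ‖r ^ n * (Real.sin (2 * π * n * y) / (n : ℝ) ^ 2)‖ ≤ 1 / (n : ℝ) ^ 2 := by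
  rw [norm_mul, norm_div, Real.norm_eq_abs, Real.norm_eq_abs, Real.norm_eq_abs,
    abs_of_nonneg (pow_nonneg hr0 n), abs_of_nonneg (sq_nonneg (n : ℝ))]
  calc r ^ n * (|Real.sin (2 * π * n * y)| / (n : ℝ) ^ 2)
      ≤ 1 * (1 / (n : ℝ) ^ 2) := by
        gcongr
        · exact pow_le_one₀ hr0 hr1
        · exact Real.abs_sin_le_one _
    _ = _ := one_mul _

lemma summable_clausen_term {r : ℝ} (hr0 : 0 ≤ r) (hr1 : r ≤ 1) (y : ℝ) :
    Summable fun n : ℕ => r ^ n * (Real.sin (2 * π * n * y) / (n : ℝ) ^ 2) :=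
  .of_norm_bounded (Real.summable_one_div_nat_pow.mpr one_lt_two)
    (norm_clausen_term_le hr0 hr1 y)

lemma tendsto_clausen_one (y : ℝ) :
    Tendsto (fun r => clausen r y) (nhdsWithin 1 (Set.Iio 1)) (nhds (clausen 1 y)) := by
  refine tendsto_tsum_of_dominated_convergence
    (Real.summable_one_div_nat_pow.mpr one_lt_two) (fun n => ?_) ?_
  · have : Continuous fun r : ℝ => r ^ n * (Real.sin (2 * π * n * y) / (n : ℝ) ^ 2) := by
      fun_prop
    exact (this.tendsto 1).mono_left nhdsWithin_le_nhds
  · filter_upwards [Ioo_mem_nhdsLT (zero_lt_one (α := ℝ))] with r hr n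
    exact norm_clausen_term_le hr.1.le hr.2.le y n

lemma hasDerivAt_clausen {r : ℝ} (hr0 : 0 ≤ r) (hr1 : r < 1) (y : ℝ) :
    HasDerivAt (clausen r)
      (-(2 * π) * Real.log ‖1 - (r : ℂ) * Complex.exp ((2 * π * y : ℝ) * Complex.I)‖) y := by
  have key : HasDerivAt (clausen r)
      (∑' n : ℕ, r ^ n * (2 * π * n * Real.cos (2 * π * n * y) / (n : ℝ) ^ 2)) y := by
    have hu : Summable fun n : ℕ => 2 * π * r ^ n :=
      (summable_geometric_of_lt_one hr0 hr1).mul_left _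
    refine hasDerivAt_tsum
      (g := fun (n : ℕ) (z : ℝ) => r ^ n * (Real.sin (2 * π * n * z) / (n : ℝ) ^ 2))
      (g' := fun (n : ℕ) (z : ℝ) => r ^ n * (2 * π * n * Real.cos (2 * π * n * z) / (n : ℝ) ^ 2))
      (y₀ := 0) hu (fun n z => ?_) (fun n z => ?_) (summable_clausen_term hr0 hr1.le 0) y
    · have h1 : HasDerivAt (fun z : ℝ => 2 * π * n * z) (2 * π * n) z := by
        simpa using (hasDerivAt_id z).const_mul (2 * π * n)
      have h2 := (h1.sin.div_const ((n : ℝ) ^ 2)).const_mul (r ^ n)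
      rwa [mul_comm (Real.cos _)] at h2
    · rcases n.eq_zero_or_pos with rfl | hn
      · simp [pi_pos.le]
      have hn' : (1 : ℝ) ≤ n := by exact_mod_cast hn
      rw [norm_mul, norm_div, norm_mul, Real.norm_of_nonneg (pow_nonneg hr0 n),
        Real.norm_of_nonneg (by positivity : 0 ≤ 2 * π * (n : ℝ)),
        Real.norm_of_nonneg (sq_nonneg (n : ℝ)), mul_comm]
      gcongr
      rw [div_le_iff₀ (by positivity)]
      have hc : ‖Real.cos (2 * π * n * z)‖ ≤ 1 := Real.abs_cos_le_one _
      calc 2 * π * n * ‖Real.cos (2 * π * n * z)‖ ≤ 2 * π * n * 1 := by gcongr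
        _ ≤ 2 * π * n * n := by gcongr
        _ = 2 * π * (n : ℝ) ^ 2 := by ring
  convert key using 1
  set w : ℂ := (r : ℂ) * Complex.exp ((2 * π * y : ℝ) * Complex.I) with hw
  have hnw : ‖w‖ < 1 := by
    rw [hw, norm_mul, Complex.norm_exp_ofReal_mul_I, mul_one, Complex.norm_real,
      Real.norm_of_nonneg hr0]
    exact hr1
  have h := (Complex.hasSum_re (Complex.hasSum_taylorSeries_neg_log hnw)).mul_left (2 * π)
  rw [Complex.neg_re, Complex.log_re] at h
  rw [neg_mul, ← mul_neg, ← h.tsum_eq]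
  refine tsum_congr fun n => ?_
  have hre : (w ^ n / (n : ℂ)).re = r ^ n * Real.cos (2 * π * n * y) / n := by
    rw [Complex.div_natCast_re, hw, mul_pow, ← Complex.exp_nat_mul, ← Complex.ofReal_pow,
      Complex.re_ofReal_mul]
    have : (n : ℂ) * ((2 * π * y : ℝ) * Complex.I)
        = ((2 * π * n * y : ℝ) : ℂ) * Complex.I := by push_cast; ring
    rw [this, Complex.exp_ofReal_mul_I_re]
  rw [hre]
  rcases n.eq_zero_or_pos with rfl | hn
  · simp
  · field_simp

lemma le_clausen_sub {a b M : ℝ} (hab : a ≤ b) (hM : 0 < M)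
    (h : ∀ y ∈ Set.Icc a b, ‖1 - Complex.exp ((2 * π * y : ℝ) * Complex.I)‖ ≤ M) :
    -(2 * π) * Real.log M * (b - a) ≤ clausen 1 b - clausen 1 a := by
  have hlim : Tendsto (fun r : ℝ => -(2 * π) * Real.log (M + (1 - r)) * (b - a))
      (nhdsWithin 1 (Set.Iio 1)) (nhds (-(2 * π) * Real.log M * (b - a))) := by
    have : ContinuousAt (fun r : ℝ => -(2 * π) * Real.log (M + (1 - r)) * (b - a)) 1 := by
      have : M + (1 - 1) ≠ 0 := by simpa using hM.ne'
      fun_prop (disch := assumption)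
    simpa [ContinuousAt] using this.tendsto.mono_left nhdsWithin_le_nhds
  refine le_of_tendsto_of_tendsto hlim
    ((tendsto_clausen_one b).sub (tendsto_clausen_one a)) ?_
  filter_upwards [Ioo_mem_nhdsLT (zero_lt_one (α := ℝ))] with r hr
  have hd := hasDerivAt_clausen hr.1.le hr.2
  refine (convex_Icc a b).mul_sub_le_image_sub_of_le_deriv
    (fun y _ => (hd y).continuousAt.continuousWithinAt)
    (fun y _ => (hd y).differentiableAt.differentiableWithinAt) (fun y hy => ?_)
    a ⟨le_rfl, hab⟩ b ⟨hab, le_rfl⟩ hab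
  rw [(hd y).deriv, neg_mul, neg_mul, neg_le_neg_iff]
  set e := Complex.exp ((2 * π * y : ℝ) * Complex.I) with he
  have hne : ‖(r : ℂ) * e‖ = r := by
    rw [he, norm_mul, Complex.norm_exp_ofReal_mul_I, mul_one, Complex.norm_real,
      Real.norm_of_nonneg hr.1.le]
  have hpos : 0 < ‖1 - (r : ℂ) * e‖ := by
    have := norm_sub_norm_le (1 : ℂ) ((r : ℂ) * e)
    rw [hne, norm_one] at this
    linarith [hr.2]
  have hle : ‖1 - (r : ℂ) * e‖ ≤ M + (1 - r) := by
    have h1 : 1 - (r : ℂ) * e = (r : ℂ) * (1 - e) + ((1 - r : ℝ) : ℂ) := by push_cast; ring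
    have h2 := h y (interior_subset hy)
    rw [h1]
    refine (norm_add_le _ _).trans ?_
    rw [norm_mul, Complex.norm_real, Complex.norm_real, Real.norm_of_nonneg hr.1.le,
      Real.norm_of_nonneg (sub_nonneg.2 hr.2.le)]
    nlinarith [hr.1, hr.2, norm_nonneg (1 - e)]
  gcongr

lemma norm_one_sub_exp_le_two (y : ℝ) :
    ‖1 - Complex.exp ((2 * π * y : ℝ) * Complex.I)‖ ≤ 2 := by
  refine (norm_sub_le _ _).trans ?_
  rw [Complex.norm_exp_ofReal_mul_I, norm_one]
  norm_num

lemma norm_one_sub_exp_le (y : ℝ) (k : ℤ) :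
    ‖1 - Complex.exp ((2 * π * y : ℝ) * Complex.I)‖ ≤ 2 * π * |y - k| := by
  have h : Complex.exp ((2 * π * y : ℝ) * Complex.I)
      = Complex.exp (Complex.I * (2 * π * (y - k) : ℝ)) := by
    rw [Complex.exp_eq_exp_iff_exists_int]
    exact ⟨k, by push_cast; ring⟩
  rw [h, norm_sub_rev]
  refine (Real.norm_exp_I_mul_ofReal_sub_one_le).trans ?_
  rw [norm_mul, Real.norm_of_nonneg (by positivity), Real.norm_eq_abs]

lemma summable_pnat_inv_sq : Summable fun m : ℕ+ => 1 / (m : ℝ) ^ 2 :=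
  (Real.summable_one_div_nat_pow.mpr one_lt_two).comp_injective PNat.coe_injective

lemma summable_prod_sin (x : ℝ) : Summable fun p : ℕ+ × ℕ+ =>
    Real.sin (2 * π * p.2 * (p.1 * x)) / ((p.2 : ℝ) ^ 2 * (p.1 : ℝ) ^ 3) := by
  refine .of_norm_bounded (g := fun p : ℕ+ × ℕ+ => 1 / (p.1 : ℝ) ^ 2 * (1 / (p.2 : ℝ) ^ 2))
    (Summable.mul_of_nonneg (f := fun m : ℕ+ => 1 / (m : ℝ) ^ 2)
      (g := fun m : ℕ+ => 1 / (m : ℝ) ^ 2) summable_pnat_inv_sq summable_pnat_inv_sq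
      (fun m => by positivity) fun m => by positivity) fun p => ?_
  have h1 : (1 : ℝ) ≤ p.1 := by exact_mod_cast p.1.2
  rw [norm_div, Real.norm_of_nonneg (by positivity : 0 ≤ (p.2 : ℝ) ^ 2 * (p.1 : ℝ) ^ 3),
    div_mul_div_comm, one_mul, mul_comm ((p.1 : ℝ) ^ 2)]
  gcongr
  · exact Real.abs_sin_le_one _
  · norm_num

lemma clausen_one_eq_tsum_pnat (y : ℝ) :
    clausen 1 y = ∑' d : ℕ+, Real.sin (2 * π * d * y) / (d : ℝ) ^ 2 := by
  have hs := summable_clausen_term zero_le_one le_rfl y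
  simp only [one_pow, one_mul] at hs
  unfold clausen
  simp only [one_pow, one_mul]
  rw [tsum_pnat_eq_tsum_succ (f := fun d : ℕ => Real.sin (2 * π * d * y) / (d : ℝ) ^ 2),
    hs.tsum_eq_zero_add]
  simp

lemma hasSum_clausen_F2 (x : ℝ) :
    HasSum (fun m : ℕ+ => clausen 1 (m * x) / (m : ℝ) ^ 3) (F2 x) := by
  have hs := summable_prod_sin x
  have hfib : ∀ m : ℕ+, ∑' d : ℕ+, Real.sin (2 * π * d * (m * x)) / ((d : ℝ) ^ 2 * (m : ℝ) ^ 3)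
      = clausen 1 (m * x) / (m : ℝ) ^ 3 := fun m => by
    rw [clausen_one_eq_tsum_pnat, ← tsum_div_const]
    exact tsum_congr fun d => by rw [div_div]
  have hsum : Summable fun m : ℕ+ => clausen 1 (m * x) / (m : ℝ) ^ 3 := by
    simpa only [hfib] using hs.prod
  have hF : F2 x = ∑' n : ℕ+, (sigma1 n : ℝ) / (n : ℝ) ^ 3 * Real.sin (2 * π * n * x) := by
    rw [tsum_pnat_eq_tsum_succ
      (f := fun n : ℕ => (sigma1 n : ℝ) / (n : ℝ) ^ 3 * Real.sin (2 * π * n * x))]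
    simp [F2]
  have hsig : Summable fun c : Σ n : ℕ+, Nat.divisorsAntidiagonal n =>
      Real.sin (2 * π * (sigmaAntidiagonalEquivProd c).2 *
        ((sigmaAntidiagonalEquivProd c).1 * x)) /
        (((sigmaAntidiagonalEquivProd c).2 : ℝ) ^ 2 *
          ((sigmaAntidiagonalEquivProd c).1 : ℝ) ^ 3) :=
    sigmaAntidiagonalEquivProd.summable_iff.mpr hs
  have htot : ∑' m : ℕ+, clausen 1 (m * x) / (m : ℝ) ^ 3 = F2 x := by
    simp only [← hfib]
    rw [← hs.tsum_prod, hF, ← sigmaAntidiagonalEquivProd.tsum_eq,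
      hsig.tsum_sigma]
    refine tsum_congr fun n => ?_
    rw [tsum_fintype]
    have hn : (n : ℝ) ≠ 0 := by exact_mod_cast n.ne_zero
    have hterm : ∀ c : Nat.divisorsAntidiagonal (n : ℕ),
        Real.sin (2 * π * (sigmaAntidiagonalEquivProd ⟨n, c⟩).2 *
          ((sigmaAntidiagonalEquivProd ⟨n, c⟩).1 * x)) /
          (((sigmaAntidiagonalEquivProd ⟨n, c⟩).2 : ℝ) ^ 2 *
            ((sigmaAntidiagonalEquivProd ⟨n, c⟩).1 : ℝ) ^ 3)
        = (c.1.2 : ℝ) / (n : ℝ) ^ 3 * Real.sin (2 * π * n * x) := by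
      rintro ⟨⟨a, b⟩, h⟩
      have hab := (Nat.mem_divisorsAntidiagonal.1 h).1
      have hab' : (n : ℝ) = a * b := by exact_mod_cast hab.symm
      have ha : (a : ℝ) ≠ 0 := fun h0 => hn (by rw [hab', h0, zero_mul])
      have hb : (b : ℝ) ≠ 0 := fun h0 => hn (by rw [hab', h0, mul_zero])
      change Real.sin (2 * π * (b : ℝ) * ((a : ℝ) * x)) / ((b : ℝ) ^ 2 * (a : ℝ) ^ 3) = _
      rw [hab', show 2 * π * (b : ℝ) * ((a : ℝ) * x) = 2 * π * (a * b) * x by ring]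
      field_simp
    simp only [hterm]
    rw [← Finset.sum_mul, ← Finset.sum_div,
      Finset.sum_coe_sort (n : ℕ).divisorsAntidiagonal fun c => (c.2 : ℝ),
      Nat.sum_divisorsAntidiagonal' fun _ b => (b : ℝ)]
    simp [sigma1]
  exact htot ▸ hsum.hasSum

/-- A derivative of `F2` at `x` bounds from above how well `x` is approximable. -/
lemma sum_neg_log_le_of_hasDerivAt_F2 {x D : ℝ} (hD : HasDerivAt F2 D x) (S : Finset ℕ+)
    (δ : ℕ+ → ℝ) (hδ : ∀ m ∈ S, ∃ k : ℤ, |m * x - k| < δ m) :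
    ∑ m ∈ S, -(2 * π * Real.log (π * δ m)) / (m : ℝ) ^ 2
      ≤ D + 2 * π * Real.log 2 * ∑' m : ℕ+, 1 / (m : ℝ) ^ 2 := by
  have hsub : Set.Ioi (0 : ℝ) ⊆ {0}ᶜ := fun t ht => ne_of_gt ht
  have hlim := ((hasDerivAt_iff_tendsto_slope_zero.1 hD).mono_left
    (nhdsWithin_mono 0 hsub)).add_const
      (2 * π * Real.log 2 * ∑' m : ℕ+, 1 / (m : ℝ) ^ 2)
  refine ge_of_tendsto hlim ?_
  choose! k hk using hδ
  have hev : ∀ᶠ t in nhdsWithin (0 : ℝ) (Set.Ioi 0),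
      ∀ m ∈ S, |m * (x + t) - k m| < δ m := by
    refine (Filter.eventually_all_finset S).2 fun m hm => ?_
    have hc : ContinuousAt (fun t : ℝ => |m * (x + t) - k m|) 0 := by fun_prop
    exact (hc.eventually_lt_const (by simpa using hk m hm)).filter_mono nhdsWithin_le_nhds
  filter_upwards [hev, self_mem_nhdsWithin] with t ht (htpos : 0 < t)
  have hm0 : ∀ m : ℕ+, (0 : ℝ) < m := fun m => by exact_mod_cast m.pos
  have hsum := (((hasSum_clausen_F2 (x + t)).sub (hasSum_clausen_F2 x)).mul_left t⁻¹).add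
    (summable_pnat_inv_sq.hasSum.mul_left (2 * π * Real.log 2))
  have hbound : ∀ (m : ℕ+) (M : ℝ), 0 < M →
      (∀ y ∈ Set.Icc (m * x) (m * (x + t)),
        ‖1 - Complex.exp ((2 * π * y : ℝ) * Complex.I)‖ ≤ 2 * M) →
      -(2 * π * Real.log M) / (m : ℝ) ^ 2 ≤ t⁻¹ * (clausen 1 (m * (x + t)) / (m : ℝ) ^ 3 -
        clausen 1 (m * x) / (m : ℝ) ^ 3) + 2 * π * Real.log 2 * (1 / (m : ℝ) ^ 2) := by
    intro m M hM h
    have := hm0 m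
    have h1 := le_clausen_sub (by nlinarith : m * x ≤ m * (x + t)) (by positivity) h
    rw [Real.log_mul two_ne_zero hM.ne'] at h1
    rw [← sub_nonneg]
    have h2 : t⁻¹ * (clausen 1 (m * (x + t)) / (m : ℝ) ^ 3 -
        clausen 1 (m * x) / (m : ℝ) ^ 3) + 2 * π * Real.log 2 * (1 / (m : ℝ) ^ 2) -
        -(2 * π * Real.log M) / (m : ℝ) ^ 2
        = (clausen 1 (m * (x + t)) - clausen 1 (m * x) -
          -(2 * π) * (Real.log 2 + Real.log M) * (m * (x + t) - m * x)) / (t * (m : ℝ) ^ 3) := by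
      field_simp
      ring
    rw [h2]
    exact div_nonneg (sub_nonneg.2 h1) (by positivity)
  rw [smul_eq_mul, ← hsum.tsum_eq]
  refine le_trans (Finset.sum_le_sum fun m hm => ?_) (hsum.summable.sum_le_tsum S fun m _ => ?_)
  · have hpos : 0 < δ m := (abs_nonneg _).trans_lt (hk m hm)
    refine hbound m _ (by positivity) fun y hy => (norm_one_sub_exp_le y (k m)).trans ?_
    have h1 := abs_lt.1 (hk m hm)
    have h2 := abs_lt.1 (ht m hm)
    rw [← mul_assoc]
    gcongr
    exact abs_le.2 ⟨by linarith [hy.1], by linarith [hy.2]⟩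
  · simpa using hbound m 1 one_pos fun y _ => by simpa using norm_one_sub_exp_le_two y

lemma gauss_iterate_mem {x : ℝ} (hx : x ∈ Set.Ioo (0 : ℝ) 1) (hirr : Irrational x) (n : ℕ) :
    gauss^[n] x ∈ Set.Ioo (0 : ℝ) 1 ∧ Irrational (gauss^[n] x) := by
  induction n with
  | zero => exact ⟨hx, hirr⟩
  | succ n ih =>
    obtain ⟨⟨h0, -⟩, hi⟩ := ih
    rw [Function.iterate_succ_apply', gauss, if_neg h0.ne']
    have hfr : Irrational (Int.fract (gauss^[n] x)⁻¹) := by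
      rw [← Int.self_sub_floor]
      exact hi.inv.sub_intCast _
    exact ⟨⟨(Int.fract_nonneg _).lt_of_ne' hfr.ne_zero, Int.fract_lt_one _⟩, hfr⟩

lemma gauss_iterate_mul {x : ℝ} (hx : x ∈ Set.Ioo (0 : ℝ) 1) (hirr : Irrational x) (n : ℕ) :
    gauss^[n] x * (⌊(gauss^[n] x)⁻¹⌋ + gauss^[n + 1] x) = 1 := by
  have h0 := (gauss_iterate_mem hx hirr n).1.1
  rw [Function.iterate_succ_apply', gauss, if_neg h0.ne', Int.floor_add_fract,
    mul_inv_cancel₀ h0.ne']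

lemma one_le_floor_inv {y : ℝ} (hy : y ∈ Set.Ioo (0 : ℝ) 1) : 1 ≤ ⌊y⁻¹⌋ := by
  rw [Int.le_floor, Int.cast_one]
  exact (one_le_inv₀ hy.1).2 hy.2.le

lemma one_le_qden {x : ℝ} (hx : x ∈ Set.Ioo (0 : ℝ) 1) (hirr : Irrational x) :
    ∀ n, 1 ≤ qden x n
  | 0 => le_rfl
  | 1 => one_le_floor_inv hx
  | n + 2 => by
    have h1 := one_le_qden hx hirr n
    have h2 := one_le_qden hx hirr (n + 1)
    have h3 := one_le_floor_inv (gauss_iterate_mem hx hirr (n + 1)).1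
    rw [qden]
    nlinarith

lemma strictMono_qden_succ {x : ℝ} (hx : x ∈ Set.Ioo (0 : ℝ) 1) (hirr : Irrational x) :
    StrictMono fun n => qden x (n + 1) := by
  refine strictMono_nat_of_lt_succ fun n => ?_
  have h1 := one_le_qden hx hirr n
  have h2 := one_le_qden hx hirr (n + 1)
  have h3 := one_le_floor_inv (gauss_iterate_mem hx hirr (n + 1)).1
  rw [qden]
  nlinarith

/-- The errors `|q_n x - p_n|`, as products of iterates of the Gauss map. -/
def gaussProd (x : ℝ) (n : ℕ) : ℝ := ∏ i ∈ Finset.range (n + 1), gauss^[i] x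

lemma gaussProd_pos {x : ℝ} (hx : x ∈ Set.Ioo (0 : ℝ) 1) (hirr : Irrational x) (n : ℕ) :
    0 < gaussProd x n :=
  Finset.prod_pos fun i _ => (gauss_iterate_mem hx hirr i).1.1

lemma gaussProd_recurrence {x : ℝ} (hx : x ∈ Set.Ioo (0 : ℝ) 1) (hirr : Irrational x) (n : ℕ) :
    gaussProd x n = ⌊(gauss^[n + 1] x)⁻¹⌋ * gaussProd x (n + 1) + gaussProd x (n + 2) := by
  have h1 : gaussProd x (n + 1) = gaussProd x n * gauss^[n + 1] x := Finset.prod_range_succ _ _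
  have h2 : gaussProd x (n + 2) = gaussProd x (n + 1) * gauss^[n + 2] x :=
    Finset.prod_range_succ _ _
  rw [h2, h1]
  linear_combination -gaussProd x n * gauss_iterate_mul hx hirr (n + 1)

lemma gaussProd_mul_qden {x : ℝ} (hx : x ∈ Set.Ioo (0 : ℝ) 1) (hirr : Irrational x) (n : ℕ) :
    gaussProd x n * qden x (n + 1) + gaussProd x (n + 1) * qden x n = 1 := by
  induction n with
  | zero =>
    have h := gauss_iterate_mul hx hirr 0
    simp only [Function.iterate_zero, id] at h
    simp only [gaussProd, Finset.prod_range_succ, Finset.range_zero, Finset.prod_empty, qden,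
      Function.iterate_zero, id, Int.cast_one, zero_add]
    linear_combination h
  | succ n ih =>
    rw [qden]
    push_cast
    linear_combination ih - qden x (n + 1) * gaussProd_recurrence hx hirr n

lemma exists_qden_mul_sub_eq {x : ℝ} (hx : x ∈ Set.Ioo (0 : ℝ) 1) (hirr : Irrational x) :
    ∀ n, ∃ p : ℤ, qden x n * x - p = (-1) ^ n * gaussProd x n
  | 0 => ⟨0, by simp [qden, gaussProd]⟩
  | 1 => ⟨1, by
      have h := gauss_iterate_mul hx hirr 0
      simp only [Function.iterate_zero, id] at h
      simp only [gaussProd, Finset.prod_range_succ, Finset.range_zero, Finset.prod_empty, qden,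
        Function.iterate_zero, id, Int.cast_one, zero_add] at h ⊢
      linear_combination h⟩
  | n + 2 => by
    obtain ⟨p, hp⟩ := exists_qden_mul_sub_eq hx hirr n
    obtain ⟨p', hp'⟩ := exists_qden_mul_sub_eq hx hirr (n + 1)
    refine ⟨⌊(gauss^[n + 1] x)⁻¹⌋ * p' + p, ?_⟩
    rw [qden]
    push_cast
    linear_combination hp + ⌊(gauss^[n + 1] x)⁻¹⌋ * hp' +
      (-1) ^ n * gaussProd_recurrence hx hirr n

lemma exists_abs_qden_mul_sub_lt {x : ℝ} (hx : x ∈ Set.Ioo (0 : ℝ) 1) (hirr : Irrational x)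
    (n : ℕ) : ∃ p : ℤ, |qden x n * x - p| < 1 / qden x (n + 1) := by
  obtain ⟨p, hp⟩ := exists_qden_mul_sub_eq hx hirr n
  have hq : (1 : ℝ) ≤ qden x n := by exact_mod_cast one_le_qden hx hirr n
  have hq' : (1 : ℝ) ≤ qden x (n + 1) := by exact_mod_cast one_le_qden hx hirr (n + 1)
  refine ⟨p, ?_⟩
  rw [hp, abs_mul, abs_pow, abs_neg, abs_one, one_pow, one_mul,
    abs_of_pos (gaussProd_pos hx hirr n), lt_div_iff₀ (by positivity)]
  nlinarith [gaussProd_mul_qden hx hirr n, gaussProd_pos hx hirr (n + 1)]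

/-- If `x ∈ (0,1)` is irrational and not square-Brjuno, i.e.
`∑_{n=0}^∞ log(q_{n+1}(x))/q_n(x)² = ∞`, then `F₂` is not differentiable at `x`. -/
theorem F2_not_differentiableAt_of_not_squareBrjuno (x : ℝ) (hx : x ∈ Set.Ioo (0 : ℝ) 1)
    (hirr : Irrational x)
    (hB : ¬ Summable fun n : ℕ => Real.log ((qden x (n + 1) : ℝ)) / (qden x n : ℝ) ^ 2) :
    ¬ DifferentiableAt ℝ F2 x := by
  intro hdiff
  apply hB
  have hq : ∀ n, (1 : ℝ) ≤ qden x n := fun n => by exact_mod_cast one_le_qden hx hirr n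
  have hmono := strictMono_qden_succ hx hirr
  let Q : ℕ → ℕ+ := fun n =>
    ⟨(qden x (n + 1)).toNat, by have := one_le_qden hx hirr (n + 1); omega⟩
  have hQ : ∀ n, ((Q n : ℕ) : ℤ) = qden x (n + 1) := fun n =>
    Int.toNat_of_nonneg (by have := one_le_qden hx hirr (n + 1); omega)
  have hQr : ∀ n, ((Q n : ℕ) : ℝ) = qden x (n + 1) := fun n => by
    rw [← hQ n, Int.cast_natCast]
  have hinj : Function.Injective Q := fun a b hab => hmono.injective (by
    simp only [← hQ, hab])
  have hinv : Summable fun n => 1 / (qden x (n + 1) : ℝ) ^ 2 := by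
    simpa only [Function.comp_def, hQr] using summable_pnat_inv_sq.comp_injective hinj
  rw [← summable_nat_add_iff 1]
  refine summable_of_sum_range_le (c := (deriv F2 x +
      2 * π * Real.log 2 * ∑' m : ℕ+, 1 / (m : ℝ) ^ 2) / (2 * π) +
      Real.log π * ∑' n, 1 / (qden x (n + 1) : ℝ) ^ 2)
    (fun n => div_nonneg (Real.log_nonneg (hq _)) (sq_nonneg _)) fun N => ?_
  let δ : ℕ+ → ℝ := fun m => 1 / (qden x (Function.invFun Q m + 2) : ℝ)
  have hδ : ∀ n, δ (Q n) = 1 / (qden x (n + 2) : ℝ) := fun n => by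
    simp only [δ, Function.leftInverse_invFun hinj n]
  have hmain := sum_neg_log_le_of_hasDerivAt_F2 hdiff.hasDerivAt
    ((Finset.range N).map ⟨Q, hinj⟩) δ (by
      intro m hm
      obtain ⟨n, -, rfl⟩ := Finset.mem_map.1 hm
      change ∃ k : ℤ, |((Q n : ℕ) : ℝ) * x - k| < δ (Q n)
      rw [hδ, hQr]
      exact exists_abs_qden_mul_sub_lt hx hirr (n + 1))
  rw [Finset.sum_map] at hmain
  have hterm : ∀ n, Real.log (qden x (n + 2)) / (qden x (n + 1) : ℝ) ^ 2 =
      (-(2 * π * Real.log (π * δ (Q n))) / ((Q n : ℕ) : ℝ) ^ 2) / (2 * π) +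
        Real.log π * (1 / (qden x (n + 1) : ℝ) ^ 2) := fun n => by
    have h1 := hq (n + 1)
    have h2 := hq (n + 2)
    have h3 : (qden x (n + 2) : ℝ) ≠ 0 := by positivity
    rw [hδ, hQr, mul_one_div, Real.log_div pi_ne_zero h3]
    field_simp
    ring
  simp only [hterm]
  rw [Finset.sum_add_distrib, ← Finset.sum_div, ← Finset.mul_sum]
  have hlogpi : 0 ≤ Real.log π := Real.log_nonneg (by linarith [pi_gt_three])
  gcongr
  · exact hmain
  · exact hinv.sum_le_tsum _ fun n _ => by positivity

end
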